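/- Let (X,T) be a Polish dynamical system. For every non-empty compact connected subset V of the space of T-invariant measures M_T(X) (with the weak* topology), there exists an asymptotic average pseudo-orbit {x_i}_{i≥0} for T such that the set of weak* limit points of the empirical measures (1/n)Σ_{i=0}^{n-1} δ_{x_i} is exactly V. -/

import Mathlib

open MeasureTheory Filter Topology
open scoped ENNReal NNReal

section Defs

variable {X : Type*} [MetricSpace X] [MeasurableSpace X] [BorelSpace X]

/-- Kantorovich–Rubinshtein (dual-Lipschitz) distance between two measures:
the supremum of `|∫ f dμ - ∫ f dν|` over bounded `f` with Lipschitz constant at most `1`. -/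
noncomputable def krDist (μ ν : Measure X) : ℝ :=
  sSup { r : ℝ | ∃ f : X → ℝ, LipschitzWith 1 f ∧ (∃ C, ∀ x, |f x| ≤ C) ∧
    r = |∫ x, f x ∂μ - ∫ x, f x ∂ν| }

/-- Empirical measure of the first `n` terms of a sequence (as a plain measure). -/
noncomputable def empMeas (x : ℕ → X) (n : ℕ) : Measure X :=
  (n : ℝ≥0∞)⁻¹ • ∑ i ∈ Finset.range n, Measure.dirac (x i)

/-- Average of the Dirac measures at the first `max n 1` points of a sequence, as a
probability measure.  For `n ≥ 1` this is the `n`-th empirical measure. -/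
noncomputable def avgDirac (x : ℕ → X) (n : ℕ) : ProbabilityMeasure X :=
  ⟨((max n 1 : ℕ) : ℝ≥0∞)⁻¹ • ∑ i ∈ Finset.range (max n 1), Measure.dirac (x i), by
    constructor
    have h : (∑ i ∈ Finset.range (max n 1), Measure.dirac (x i)) Set.univ
        = ((max n 1 : ℕ) : ℝ≥0∞) := by
      simp [Measure.finset_sum_apply]
    rw [Measure.smul_apply, h, smul_eq_mul]
    exact ENNReal.inv_mul_cancel (by simp) (by simp)⟩

/-- The set of weak* limit points of the empirical measures of a sequence. -/
def limitMeasures (x : ℕ → X) : Set (ProbabilityMeasure X) :=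
  { μ | ∃ φ : ℕ → ℕ, StrictMono φ ∧ Tendsto (fun k => avgDirac x (φ k)) atTop (𝓝 μ) }

/-- `x` is a generic point for `μ`: the empirical measures along the orbit of `x`
converge to `μ` in the weak* topology. -/
def genericFor (T : X → X) (x : X) (μ : ProbabilityMeasure X) : Prop :=
  Tendsto (fun n => avgDirac (fun i => T^[i] x) n) atTop (𝓝 μ)

/-- The invariant measure supported on the periodic orbit of `x` of period `p`. -/
noncomputable def periodicOrbitMeasure (T : X → X) (x : X) (p : ℕ) : ProbabilityMeasure X :=
  avgDirac (fun i => T^[i] x) p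

/-- The set of invariant measures supported on periodic orbits of points of `K`. -/
def perMeasures (T : X → X) (K : Set X) : Set (ProbabilityMeasure X) :=
  { μ | ∃ x ∈ K, ∃ p, 0 < p ∧ T^[p] x = x ∧ μ = periodicOrbitMeasure T x p }

/-- The mean orbital pseudo-metric `Ē`. -/
noncomputable def meanOrbitalDist (T : X → X) (x y : X) : ℝ :=
  limsup (fun n => ⨅ σ : Equiv.Perm (Fin n),
    (∑ i : Fin n, dist (T^[(i : ℕ)] x) (T^[((σ i : Fin n) : ℕ)] y)) / n) atTop

/-- `x` is an asymptotic average pseudo-orbit for `T`. -/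
def IsAAPO (T : X → X) (x : ℕ → X) : Prop :=
  Tendsto (fun n => (∑ i ∈ Finset.range n, dist (T (x i)) (x (i + 1))) / n) atTop (𝓝 0)

/-- The point `x` is `K`-closable. -/
def ClosableAt (T : X → X) (K : Set X) (x : X) : Prop :=
  ∀ ε > (0 : ℝ), ∀ N : ℕ, ∃ p q : ℕ, 0 < p ∧ N ≤ p ∧ p ≤ q ∧ (q : ℝ) ≤ (1 + ε) * p ∧
    ∃ y ∈ K, T^[q] y = y ∧ ∀ i < p, dist (T^[i] y) (T^[i] x) < ε

/-- The set `K ⊆ Per(T)` is linkable. -/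
def Linkable (T : X → X) (K : Set X) : Prop :=
  ∀ y₁ ∈ K, ∀ y₂ ∈ K, ∀ ε > (0 : ℝ), ∀ lam ∈ Set.Icc (0 : ℝ) 1,
    ∃ p₁ p₂ q₁ q₂ : ℕ, 0 < p₁ ∧ 0 < p₂ ∧ T^[p₁] y₁ = y₁ ∧ T^[p₂] y₂ = y₂ ∧
      ∃ z ∈ K, T^[q₂] z = z ∧
        lam - ε ≤ (p₁ : ℝ) / (p₁ + p₂) ∧ (p₁ : ℝ) / (p₁ + p₂) ≤ lam + ε ∧
        p₁ ≤ q₁ ∧ (q₁ : ℝ) ≤ (1 + ε) * p₁ ∧ (∀ i < p₁, dist (T^[i] z) (T^[i] y₁) < ε) ∧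
        p₂ ≤ q₂ - q₁ ∧ ((q₂ - q₁ : ℕ) : ℝ) ≤ (1 + ε) * p₂ ∧
        (∀ i < p₂, dist (T^[i + q₁] z) (T^[i] y₂) < ε)

/-- `(X,T)` has the asymptotic orbital average shadowing property. -/
def AOASP (T : X → X) : Prop :=
  ∀ x : ℕ → X, IsAAPO T x → ∃ z : X,
    Tendsto (fun n => ⨅ σ : Equiv.Perm (Fin n),
      (∑ i : Fin n, dist (x (i : ℕ)) (T^[((σ i : Fin n) : ℕ)] z)) / n) atTop (𝓝 0)

end Defs

section Segments

/-- The start of the `k`-th segment when `ℕ` is cut into consecutive segments of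
lengths `ℓ 0, ℓ 1, …`. -/
def segStart (ℓ : ℕ → ℕ) (k : ℕ) : ℕ := ∑ j ∈ Finset.range k, ℓ j

/-- The pair (segment, offset in the segment) of a natural number. -/
def segPos (ℓ : ℕ → ℕ) : ℕ → ℕ × ℕ
  | 0 => (0, 0)
  | n + 1 => if (segPos ℓ n).2 + 1 < ℓ (segPos ℓ n).1 then
      ((segPos ℓ n).1, (segPos ℓ n).2 + 1) else ((segPos ℓ n).1 + 1, 0)

variable {ℓ : ℕ → ℕ}

theorem segStart_succ (k : ℕ) : segStart ℓ (k + 1) = segStart ℓ k + ℓ k :=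
  Finset.sum_range_succ _ _

theorem segPos_spec (hℓ : ∀ k, 0 < ℓ k) (n : ℕ) :
    (segPos ℓ n).2 < ℓ (segPos ℓ n).1 ∧ segStart ℓ (segPos ℓ n).1 + (segPos ℓ n).2 = n := by
  induction n with
  | zero => simp [segPos, segStart, hℓ]
  | succ n ih =>
    rw [segPos]
    split_ifs with h
    · exact ⟨h, by simp only; omega⟩
    · exact ⟨hℓ _, by simp only [segStart_succ]; omega⟩

theorem segPos_add_of_eq {n k s : ℕ} (h : segPos ℓ n = (k, 0)) (hs : s < ℓ k) :
    segPos ℓ (n + s) = (k, s) := by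
  induction s with
  | zero => exact h
  | succ s ih =>
    rw [← add_assoc, segPos, ih (by omega)]
    simp [hs]

theorem segPos_segStart (hℓ : ∀ k, 0 < ℓ k) (k : ℕ) : segPos ℓ (segStart ℓ k) = (k, 0) := by
  induction k with
  | zero => rfl
  | succ k ih =>
    obtain ⟨m, hm⟩ : ∃ m, ℓ k = m + 1 := ⟨ℓ k - 1, by have := hℓ k; omega⟩
    rw [segStart_succ, hm, ← add_assoc, segPos, segPos_add_of_eq ih (by omega)]
    simp [hm]

theorem segPos_segStart_add (hℓ : ∀ k, 0 < ℓ k) {k s : ℕ} (hs : s < ℓ k) :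
    segPos ℓ (segStart ℓ k + s) = (k, s) :=
  segPos_add_of_eq (segPos_segStart hℓ k) hs

theorem tendsto_segPos_fst (hℓ : ∀ k, 0 < ℓ k) :
    Tendsto (fun n => (segPos ℓ n).1) atTop atTop := by
  refine tendsto_atTop_atTop_of_monotone (monotone_nat_of_le_succ fun n => ?_)
    fun k => ⟨segStart ℓ k, by simp [segPos_segStart hℓ]⟩
  rw [segPos]
  split_ifs <;> simp

theorem tendsto_segStart (hℓ : ∀ k, 0 < ℓ k) : Tendsto (segStart ℓ) atTop atTop := by
  refine tendsto_atTop_mono (fun k => ?_) tendsto_id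
  induction k with
  | zero => simp
  | succ k ih => have := hℓ k; simp only [id, segStart_succ] at *; omega

theorem sum_range_segStart_add (hℓ : ∀ k, 0 < ℓ k) (h : ℕ × ℕ → ℝ) {k t : ℕ} (ht : t ≤ ℓ k) :
    ∑ i ∈ Finset.range (segStart ℓ k + t), h (segPos ℓ i) =
      ∑ i ∈ Finset.range (segStart ℓ k), h (segPos ℓ i) + ∑ s ∈ Finset.range t, h (k, s) := by
  rw [Finset.sum_range_add]
  congr 1
  refine Finset.sum_congr rfl fun s hs => ?_
  rw [segPos_segStart_add hℓ ((Finset.mem_range.1 hs).trans_le ht)]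

theorem sum_range_mod_mul (a : ℕ → ℝ) (L q : ℕ) :
    ∑ s ∈ Finset.range (L * q), a (s % L) = q * ∑ s ∈ Finset.range L, a s := by
  induction q with
  | zero => simp
  | succ q ih =>
    rw [Nat.mul_succ, Finset.sum_range_add, ih]
    have : ∑ x ∈ Finset.range L, a ((L * q + x) % L) = ∑ x ∈ Finset.range L, a x :=
      Finset.sum_congr rfl fun s hs => by
        rw [Nat.mul_add_mod, Nat.mod_eq_of_lt (Finset.mem_range.1 hs)]
    rw [this]
    push_cast
    ring

theorem abs_sum_range_le {a : ℕ → ℝ} {M : ℝ} (hM : ∀ i, |a i| ≤ M) (n : ℕ) :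
    |∑ i ∈ Finset.range n, a i| ≤ M * n := by
  refine (Finset.abs_sum_le_sum_abs _ _).trans ((Finset.sum_le_sum fun i _ => hM i).trans ?_)
  simp [mul_comm]

theorem abs_sum_range_mod_le {a : ℕ → ℝ} {M e : ℝ} {L : ℕ} (hM : ∀ i, |a i| ≤ M)
    (he : |∑ s ∈ Finset.range L, a s| ≤ e * L) (t : ℕ) :
    |∑ s ∈ Finset.range t, a (s % L)| ≤ e * (L * (t / L) : ℕ) + M * (t % L : ℕ) := by
  conv_lhs => rw [← Nat.div_add_mod t L, Finset.sum_range_add, sum_range_mod_mul]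
  refine (abs_add_le _ _).trans (add_le_add ?_ (abs_sum_range_le (fun i => hM _) _))
  rw [abs_mul, Nat.abs_cast]
  calc _ ≤ ((t / L : ℕ) : ℝ) * (e * L) := by gcongr
    _ = _ := by push_cast; ring

theorem exists_fast_repetitions {L : ℕ → ℕ} (hL : ∀ k, 0 < L k) :
    ∃ r : ℕ → ℕ, (∀ k, 0 < r k) ∧ ∀ k,
      (k + 1) * segStart (fun k => r k * L k) k ≤ segStart (fun k => r k * L k) (k + 1) ∧
      (k + 1) * L (k + 1) ≤ segStart (fun k => r k * L k) (k + 1) := by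
  let S : ℕ → ℕ := fun k =>
    Nat.rec 0 (fun k s => s + (k + 1) * (s + L (k + 1)) * L k) k
  have hS : ∀ k, segStart (fun k => (k + 1) * (S k + L (k + 1)) * L k) k = S k := by
    intro k
    induction k with
    | zero => rfl
    | succ k ih => rw [segStart_succ, ih]
  refine ⟨fun k => (k + 1) * (S k + L (k + 1)), fun k => ?_, fun k => ?_⟩
  · have := hL (k + 1)
    positivity
  · have h1 : (k + 1) * (S k + L (k + 1)) ≤ (k + 1) * (S k + L (k + 1)) * L k :=
      Nat.le_mul_of_pos_right _ (hL k)
    rw [segStart_succ, hS]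
    constructor <;> nlinarith

/-- Cesàro averages along repeated blocks follow the block averages, provided that these vary
slowly and every segment is long compared to its predecessors and to the next block. -/
theorem tendsto_average_sub_of_blocks {r L : ℕ → ℕ} (hL : ∀ k, 0 < L k) (hr : ∀ k, 0 < r k)
    (hS : ∀ k,
      (k + 1) * segStart (fun k => r k * L k) k ≤ segStart (fun k => r k * L k) (k + 1) ∧
      (k + 1) * L (k + 1) ≤ segStart (fun k => r k * L k) (k + 1))
    {g : ℕ → ℕ → ℝ} {c e : ℕ → ℝ} {M : ℝ} (hg : ∀ k s, |g k s| ≤ M) (hcM : ∀ k, |c k| ≤ M)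
    (hgc : ∀ k, |∑ s ∈ Finset.range (L k), (g k s - c k)| ≤ e k * L k)
    (he : Tendsto e atTop (𝓝 0)) (hc : Tendsto (fun k => c (k + 1) - c k) atTop (𝓝 0)) :
    Tendsto (fun n : ℕ => (∑ i ∈ Finset.range n, g (segPos (fun k => r k * L k) i).1
      ((segPos (fun k => r k * L k) i).2 % L (segPos (fun k => r k * L k) i).1)) / n
        - c (segPos (fun k => r k * L k) n).1) atTop (𝓝 0) := by
  set ℓ : ℕ → ℕ := fun k => r k * L k with hℓdef
  have hℓ : ∀ k, 0 < ℓ k := fun k => Nat.mul_pos (hr k) (hL k)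
  have hM0 : 0 ≤ M := (abs_nonneg _).trans (hcM 0)
  have he0 : ∀ k, 0 ≤ e k := fun k => by
    have h1 := (abs_nonneg _).trans (hgc k)
    have h2 : (0 : ℝ) < L k := by exact_mod_cast hL k
    exact nonneg_of_mul_nonneg_left h1 h2
  let δ : ℕ → ℝ := fun k => 4 * M * (1 / ((k : ℝ) + 1)) + e k + |c (k + 1) - c k| + e (k + 1)
  have hδ : Tendsto δ atTop (𝓝 0) := by
    have h1 := (tendsto_one_div_add_atTop_nhds_zero_nat (𝕜 := ℝ)).const_mul (4 * M)
    have h2 := ((h1.add he).add hc.abs).add (he.comp (tendsto_add_atTop_nat 1))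
    simpa [δ] using h2
  have key : ∀ n k : ℕ, (segPos ℓ n).1 = k + 1 →
      |(∑ i ∈ Finset.range n, g (segPos ℓ i).1 ((segPos ℓ i).2 % L (segPos ℓ i).1)) / n
        - c (segPos ℓ n).1| ≤ δ k := by
    intro n k hk
    obtain ⟨ht, hn⟩ := segPos_spec hℓ n
    rw [hk] at ht hn ⊢
    set t := (segPos ℓ n).2
    obtain ⟨hS1, hS2⟩ := hS k
    have hSpos : 0 < segStart ℓ (k + 1) := by rw [segStart_succ]; have := hℓ k; omega
    have hn0 : (0 : ℝ) < n := by exact_mod_cast (show 0 < n by omega)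
    have hsum : ∑ i ∈ Finset.range n, (g (segPos ℓ i).1 ((segPos ℓ i).2 % L (segPos ℓ i).1)
        - c (k + 1)) =
        ∑ i ∈ Finset.range (segStart ℓ k),
          (g (segPos ℓ i).1 ((segPos ℓ i).2 % L (segPos ℓ i).1) - c (k + 1)) +
        (∑ s ∈ Finset.range (ℓ k), (g k (s % L k) - c k) + ℓ k * (c k - c (k + 1))) +
        ∑ s ∈ Finset.range t, (g (k + 1) (s % L (k + 1)) - c (k + 1)) := by
      rw [← hn, sum_range_segStart_add hℓ (fun p => g p.1 (p.2 % L p.1) - c (k + 1)) ht.le,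
        segStart_succ, sum_range_segStart_add hℓ (fun p => g p.1 (p.2 % L p.1) - c (k + 1)) le_rfl]
      congr 2
      simp only [Finset.sum_sub_distrib, Finset.sum_const, Finset.card_range, nsmul_eq_mul]
      ring
    have hb : ∀ j k s, |g j s - c k| ≤ 2 * M := fun j k s =>
      (abs_sub _ _).trans (by linarith [hg j s, hcM k])
    have b1 := abs_sum_range_le (a := fun i =>
      g (segPos ℓ i).1 ((segPos ℓ i).2 % L (segPos ℓ i).1) - c (k + 1))
      (fun i => hb _ _ _) (segStart ℓ k)
    have b2 := abs_sum_range_mod_le (a := fun s => g k s - c k) (fun i => hb _ _ _) (hgc k) (ℓ k)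
    have b3 := abs_sum_range_mod_le (a := fun s => g (k + 1) s - c (k + 1)) (fun i => hb _ _ _)
      (hgc (k + 1)) t
    have e1 : L k * (ℓ k / L k) = ℓ k := Nat.mul_div_cancel' (Dvd.intro_left _ rfl)
    have e2 : ℓ k % L k = 0 := Nat.mul_mod_left _ _
    rw [e1, e2] at b2
    have hln : (ℓ k : ℝ) ≤ n := by
      rw [segStart_succ] at hn
      exact_mod_cast (show ℓ k ≤ n by omega)
    have hk1 : (0 : ℝ) < (k : ℝ) + 1 := by positivity
    have c1 : (segStart ℓ k : ℝ) ≤ 1 / ((k : ℝ) + 1) * n := by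
      rw [one_div_mul_eq_div, le_div_iff₀ hk1, mul_comm]
      exact_mod_cast hS1.trans (by omega)
    have c2 : ((t % L (k + 1) : ℕ) : ℝ) ≤ 1 / ((k : ℝ) + 1) * n := by
      rw [one_div_mul_eq_div, le_div_iff₀ hk1, mul_comm]
      have := Nat.mul_le_mul_left (k + 1) (Nat.mod_lt t (hL (k + 1))).le
      exact_mod_cast this.trans (hS2.trans (by omega))
    have c3 : ((L (k + 1) * (t / L (k + 1)) : ℕ) : ℝ) ≤ n := by
      exact_mod_cast (Nat.mul_div_le _ _).trans (by omega)
    have hdiv : (∑ i ∈ Finset.range n, g (segPos ℓ i).1 ((segPos ℓ i).2 % L (segPos ℓ i).1)) / n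
        - c (k + 1) = (∑ i ∈ Finset.range n,
          (g (segPos ℓ i).1 ((segPos ℓ i).2 % L (segPos ℓ i).1) - c (k + 1))) / n := by
      rw [Finset.sum_sub_distrib]
      simp only [Finset.sum_const, Finset.card_range, nsmul_eq_mul]
      field_simp
    rw [hdiv, abs_div, Nat.abs_cast, div_le_iff₀ hn0, hsum]
    refine (abs_add_le _ _).trans ((add_le_add ((abs_add_le _ _).trans
      (add_le_add b1 ((abs_add_le _ _).trans (add_le_add b2 le_rfl)))) b3).trans ?_)
    rw [abs_mul, Nat.abs_cast, abs_sub_comm]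
    have d1 : 2 * M * (segStart ℓ k : ℝ) ≤ 2 * M * (1 / ((k : ℝ) + 1) * n) := by gcongr
    have d2 : 2 * M * ((t % L (k + 1) : ℕ) : ℝ) ≤ 2 * M * (1 / ((k : ℝ) + 1) * n) := by gcongr
    have d3 := mul_le_mul_of_nonneg_left hln (he0 k)
    have d4 := mul_le_mul_of_nonneg_left c3 (he0 (k + 1))
    have d5 := mul_le_mul_of_nonneg_right hln (abs_nonneg (c (k + 1) - c k))
    simp only [δ, Nat.cast_zero, mul_zero, add_zero]
    linarith
  have hpred : Tendsto (fun n => (segPos ℓ n).1 - 1) atTop atTop :=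
    (tendsto_sub_atTop_nat 1).comp (tendsto_segPos_fst hℓ)
  refine squeeze_zero_norm' ?_ (hδ.comp hpred)
  filter_upwards [(tendsto_segPos_fst hℓ).eventually_ge_atTop 1] with n hn
  exact key n ((segPos ℓ n).1 - 1) (by omega)

end Segments

section Chains

variable {Y : Type*} [PseudoMetricSpace Y]

theorem exists_chain [PreconnectedSpace Y] {ε : ℝ} (hε : 0 < ε) (a b : Y) :
    ∃ n > 0, ∃ p : ℕ → Y, p 0 = a ∧ p n = b ∧ ∀ i < n, dist (p i) (p (i + 1)) < ε := by
  let P : Y → Y → Prop := fun a b =>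
    ∃ n > 0, ∃ p : ℕ → Y, p 0 = a ∧ p n = b ∧ ∀ i < n, dist (p i) (p (i + 1)) < ε
  have hP : ∀ a b, dist a b < ε → P a b := fun a b hab =>
    ⟨1, one_pos, fun i => if i = 0 then a else b, by simp, by simp, fun i hi => by
      obtain rfl : i = 0 := by omega
      simpa using hab⟩
  refine PreconnectedSpace.induction₂' P (fun x => ?_) ⟨?_⟩ a b
  · filter_upwards [Metric.ball_mem_nhds x hε] with y hy
    exact ⟨hP x y (by rwa [dist_comm]), hP y x hy⟩
  · rintro a b c ⟨n, hn, p, p0, pn, hp⟩ ⟨m, hm, q, q0, qm, hq⟩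
    refine ⟨n + m, by omega, fun i => if i ≤ n then p i else q (i - n), by simpa, ?_, ?_⟩
    · simp [show ¬ n + m ≤ n by omega, qm]
    · intro i hi
      rcases lt_trichotomy i n with h | rfl | h
      · simpa [h.le, Nat.succ_le_of_lt h] using hp i h
      · simpa [pn, ← q0] using hq 0 hm
      · have := hq (i - n) (by omega)
        simpa [show ¬ i ≤ n by omega, show ¬ i + 1 ≤ n by omega,
          show i + 1 - n = i - n + 1 by omega] using this

theorem exists_seq_forall_mapClusterPt [TopologicalSpace.SeparableSpace Y] [Nonempty Y] :
    ∃ w : ℕ → Y, ∀ v, MapClusterPt v atTop w := by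
  refine ⟨fun j => TopologicalSpace.denseSeq Y (Nat.unpair j).1, fun v => ?_⟩
  rw [mapClusterPt_iff_frequently]
  intro s hs
  obtain ⟨_, hi, i, rfl⟩ := mem_closure_iff_nhds.1 (TopologicalSpace.denseRange_denseSeq Y v) s hs
  exact frequently_atTop.2 fun N => ⟨Nat.pair i N, Nat.right_le_pair _ _, by simpa using hi⟩

theorem exists_slow_seq_forall_mapClusterPt [TopologicalSpace.SeparableSpace Y] [Nonempty Y]
    [PreconnectedSpace Y] :
    ∃ y : ℕ → Y, Tendsto (fun k => dist (y k) (y (k + 1))) atTop (𝓝 0) ∧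
      ∀ v, MapClusterPt v atTop y := by
  obtain ⟨w, hw⟩ := exists_seq_forall_mapClusterPt (Y := Y)
  choose ℓ hℓ p p0 pℓ hp using fun k : ℕ =>
    exists_chain (Nat.one_div_pos_of_nat (α := ℝ) (n := k)) (w k) (w (k + 1))
  let y : ℕ → Y := fun i => p (segPos ℓ i).1 (segPos ℓ i).2
  have hyw : y ∘ segStart ℓ = w := by
    ext k
    simp [y, segPos_segStart hℓ, p0]
  refine ⟨y, squeeze_zero (fun _ => dist_nonneg) (fun i => ?_)
    ((tendsto_one_div_add_atTop_nhds_zero_nat (𝕜 := ℝ)).comp (tendsto_segPos_fst hℓ)), fun v => ?_⟩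
  · obtain ⟨h1, -⟩ := segPos_spec hℓ i
    have h2 := hp _ _ h1
    have h3 : y (i + 1) = p (segPos ℓ i).1 ((segPos ℓ i).2 + 1) := by
      simp only [y]
      rw [segPos]
      split_ifs with h
      · rfl
      · rw [show (segPos ℓ i).2 + 1 = ℓ (segPos ℓ i).1 by omega, pℓ, p0]
    rw [h3]
    exact h2.le
  · exact (hyw ▸ hw v).of_comp (tendsto_segStart hℓ)

end Chains

/-- The strong law of large numbers for finitely many observables at once. -/
theorem exists_seq_forall_tendsto_average {X ι : Type*} [MeasurableSpace X] (μ : Measure X)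
    [IsProbabilityMeasure μ] (F : Finset ι) {h : ι → X → ℝ} (hm : ∀ f, Measurable (h f))
    (hint : ∀ f, Integrable (h f) μ) :
    ∃ ω : ℕ → X, ∀ f ∈ F, Tendsto (fun n : ℕ => (∑ i ∈ Finset.range n, h f (ω i)) / n) atTop
      (𝓝 (∫ x, h f x ∂μ)) := by
  let ν := Measure.infinitePi fun _ : ℕ => μ
  have hp : ∀ i : ℕ, MeasurePreserving (fun ω : ℕ → X => ω i) ν μ := fun i =>
    measurePreserving_eval_infinitePi (fun _ : ℕ => μ) i
  have hmap : ∀ f (i : ℕ), ν.map (fun ω : ℕ → X => h f (ω i)) = μ.map (h f) := fun f i => by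
    have := Measure.map_map (μ := ν) (hm f) (hp i).measurable
    rw [(hp i).map_eq] at this
    exact this.symm
  have hlln : ∀ f, ∀ᵐ ω ∂ν,
      Tendsto (fun n : ℕ => (∑ i ∈ Finset.range n, h f (ω i)) / n) atTop
        (𝓝 (∫ x, h f x ∂μ)) := by
    intro f
    have h1 := ProbabilityTheory.strong_law_ae_real (μ := ν) (fun i ω => h f (ω i))
      ((hp 0).integrable_comp_of_integrable (hint f))
      (fun i j hij => (ProbabilityTheory.iIndepFun_infinitePi
        (P := fun _ : ℕ => μ) (X := fun _ => h f) (fun _ => hm f)).indepFun hij)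
      (fun i => ⟨((hm f).comp (measurable_pi_apply i)).aemeasurable,
        ((hm f).comp (measurable_pi_apply 0)).aemeasurable, by rw [hmap, hmap]⟩)
    have h2 := integral_map (hp 0).measurable.aemeasurable
      ((hm f).aestronglyMeasurable (μ := ν.map fun ω : ℕ → X => ω 0))
    rw [(hp 0).map_eq] at h2
    rwa [h2]
  obtain ⟨ω, hω⟩ := ((ae_ball_iff F.countable_toSet).2 fun f _ => hlln f).exists
  exact ⟨ω, hω⟩

/-- An upper bound for the error `dist (T x_t) x_{t+1}` of a pseudo-orbit running through the
points `B 0, …, B (L - 1)`, where `C` bounds the error made when leaving the block. -/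
noncomputable def blockJump {X : Type*} [MetricSpace X] (T : X → X) (C : ℝ) (L : ℕ) (B : ℕ → X) (t : ℕ) : ℝ :=
  if t + 1 < L then dist (T (B t)) (B (t + 1)) else C

theorem exists_block_sum {X : Type*} [MetricSpace X] [TopologicalSpace.SeparableSpace X] [MeasurableSpace X] [BorelSpace X]
    {C : ℝ} (hC : ∀ a b : X, dist a b ≤ C) {T : X → X} (hT : Continuous T)
    (μ : ProbabilityMeasure X) (hμ : μ.toMeasure.map T = μ.toMeasure)
    (F : Finset (BoundedContinuousFunction X ℝ)) {ε : ℝ} (hε : 0 < ε) :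
    ∃ L > 0, ∃ B : ℕ → X, (∑ t ∈ Finset.range L, blockJump T C L B t ≤ ε * L) ∧
      ∀ f ∈ F, |(∑ t ∈ Finset.range L, f (B t)) / L - ∫ x, f x ∂μ.toMeasure| < ε := by
  obtain ⟨m, hm⟩ := exists_nat_gt (C / ε)
  set M := m + 1
  have hM : C ≤ ε * M := by
    rw [div_lt_iff₀ hε] at hm
    push_cast [M]
    nlinarith
  have hMpos : 0 < M := Nat.succ_pos m
  let h : BoundedContinuousFunction X ℝ → X → ℝ := fun f x =>
    (∑ i ∈ Finset.range M, f (T^[i] x)) / M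
  have hmp : MeasurePreserving T μ.toMeasure μ.toMeasure := ⟨hT.measurable, hμ⟩
  have hfi : ∀ (f : BoundedContinuousFunction X ℝ) i,
      Integrable (fun x => f (T^[i] x)) μ.toMeasure := fun f i =>
    (hmp.iterate i).integrable_comp_of_integrable (f.integrable _)
  have hcont : ∀ f, Continuous (h f) := fun f =>
    (continuous_finsetSum _ fun i _ => f.continuous.comp (hT.iterate i)).div_const _
  have hint : ∀ f, Integrable (h f) μ.toMeasure := fun f =>
    (integrable_finsetSum _ fun i _ => hfi f i).div_const _
  have hval : ∀ f, ∫ x, h f x ∂μ.toMeasure = ∫ x, f x ∂μ.toMeasure := by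
    intro f
    simp only [h]
    rw [integral_div, integral_finsetSum _ fun i _ => hfi f i]
    have : ∀ i, ∫ x, f (T^[i] x) ∂μ.toMeasure = ∫ x, f x ∂μ.toMeasure := by
      intro i
      conv_rhs => rw [← (hmp.iterate i).map_eq]
      rw [integral_map (hmp.iterate i).measurable.aemeasurable
        f.continuous.aestronglyMeasurable]
    simp only [this, Finset.sum_const, Finset.card_range, nsmul_eq_mul]
    field_simp
  obtain ⟨ω, hω⟩ := exists_seq_forall_tendsto_average μ.toMeasure F
    (fun f => (hcont f).measurable) hint
  have hev : ∀ᶠ n : ℕ in atTop, 0 < n ∧ ∀ f ∈ F,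
      |(∑ i ∈ Finset.range n, h f (ω i)) / n - ∫ x, f x ∂μ.toMeasure| < ε :=
    (eventually_gt_atTop 0).and ((Finset.eventually_all F).2 fun f hf =>
      Metric.tendsto_nhds.1 (hval f ▸ hω f hf) ε hε)
  obtain ⟨N, hN, hNF⟩ := hev.exists
  have hsum : ∀ (a : ℕ → ℝ) (n : ℕ), ∑ t ∈ Finset.range (M * n), a t =
      ∑ j ∈ Finset.range n, ∑ i ∈ Finset.range M, a (M * j + i) := by
    intro a n
    induction n with
    | zero => simp
    | succ n ih => rw [Nat.mul_succ, Finset.sum_range_add, ih, Finset.sum_range_succ _ n]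
  have hB : ∀ j i, i < M → (T^[(M * j + i) % M] (ω ((M * j + i) / M))) = T^[i] (ω j) := by
    intro j i hi
    rw [Nat.mul_add_mod, Nat.mod_eq_of_lt hi, Nat.mul_add_div hMpos, Nat.div_eq_of_lt hi, add_zero]
  refine ⟨M * N, Nat.mul_pos hMpos hN, fun t => T^[t % M] (ω (t / M)), ?_, fun f hf => ?_⟩
  · have hC0 : 0 ≤ C := dist_nonneg.trans (hC (ω 0) (ω 0))
    have hin : ∀ j < N, ∑ i ∈ Finset.range M,
        blockJump T C (M * N) (fun t => T^[t % M] (ω (t / M))) (M * j + i) ≤ C := by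
      intro j hj
      have hjN : M * j + M ≤ M * N := by rw [← Nat.mul_succ]; exact Nat.mul_le_mul_left _ hj
      have h0 : ∀ i ∈ Finset.range m,
          blockJump T C (M * N) (fun t => T^[t % M] (ω (t / M))) (M * j + i) = 0 := by
        intro i hi
        have hi' : i + 1 < M := Nat.succ_lt_succ (Finset.mem_range.1 hi)
        rw [blockJump, if_pos (by omega), add_assoc, hB j i (by omega), hB j (i + 1) hi',
          Function.iterate_succ_apply', dist_self]
      rw [Finset.sum_range_succ, Finset.sum_eq_zero h0, zero_add, blockJump]
      split_ifs
      exacts [hC _ _, le_rfl]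
    rw [hsum]
    refine (Finset.sum_le_sum fun j hj => hin j (Finset.mem_range.1 hj)).trans ?_
    simp only [Finset.sum_const, Finset.card_range, nsmul_eq_mul]
    push_cast
    have : (0 : ℝ) ≤ N := N.cast_nonneg
    nlinarith
  · have := hNF f hf
    rw [hsum]
    have e : (∑ j ∈ Finset.range N, ∑ i ∈ Finset.range M,
        f (T^[(M * j + i) % M] (ω ((M * j + i) / M)))) / ((M * N : ℕ) : ℝ) =
        (∑ j ∈ Finset.range N, h f (ω j)) / N := by
      have : ∀ j, h f (ω j) = (∑ i ∈ Finset.range M,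
          f (T^[(M * j + i) % M] (ω ((M * j + i) / M)))) / M := fun j => by
        simp only [h]
        congr 1
        exact Finset.sum_congr rfl fun i hi => by rw [hB j i (Finset.mem_range.1 hi)]
      simp only [this, ← Finset.sum_div]
      push_cast
      rw [div_div]
    rwa [e]

theorem integral_avgDirac {X : Type*} [MetricSpace X] [MeasurableSpace X] [BorelSpace X]
    (f : BoundedContinuousFunction X ℝ) (x : ℕ → X) {n : ℕ} (hn : 0 < n) :
    ∫ a, f a ∂(avgDirac x n).toMeasure = (∑ i ∈ Finset.range n, f (x i)) / n := by
  have h : (avgDirac x n).toMeasure =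
      (n : ℝ≥0∞)⁻¹ • ∑ i ∈ Finset.range n, Measure.dirac (x i) := by
    have : max n 1 = n := max_eq_left hn
    simp only [avgDirac, ProbabilityMeasure.coe_mk, this]
  have hf : StronglyMeasurable f := f.continuous.stronglyMeasurable
  rw [h, integral_smul_measure, integral_finsetSum_measure fun i _ => f.integrable _]
  simp [integral_dirac' _ _ hf, div_eq_inv_mul]

/-- An invariant measure is approximated by empirical measures of blocks with arbitrarily small
average pseudo-orbit error. -/
theorem exists_block {X : Type*} [MetricSpace X] [TopologicalSpace.SeparableSpace X]
    [MeasurableSpace X] [BorelSpace X]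
    {C : ℝ} (hC : ∀ a b : X, dist a b ≤ C) {T : X → X} (hT : Continuous T)
    (μ : ProbabilityMeasure X) (hμ : μ.toMeasure.map T = μ.toMeasure)
    {U : Set (ProbabilityMeasure X)} (hU : U ∈ 𝓝 μ) {ε : ℝ} (hε : 0 < ε) :
    ∃ L > 0, ∃ B : ℕ → X, avgDirac B L ∈ U ∧
      ∑ t ∈ Finset.range L, blockJump T C L B t ≤ ε * L := by
  classical
  choose L hL B hB hF using fun p : Finset (BoundedContinuousFunction X ℝ) × ℕ =>
    exists_block_sum hC hT μ hμ p.1 (lt_min hε (Nat.one_div_pos_of_nat (α := ℝ) (n := p.2)))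
  have hlim : Tendsto (fun p => avgDirac (B p) (L p)) atTop (𝓝 μ) := by
    rw [ProbabilityMeasure.tendsto_iff_forall_integral_tendsto]
    intro f
    refine Metric.tendsto_nhds.2 fun η hη => ?_
    obtain ⟨n, hn⟩ := exists_nat_one_div_lt hη
    filter_upwards [eventually_ge_atTop (({f} : Finset _), n)] with p hp
    rw [integral_avgDirac f _ (hL p), Real.dist_eq]
    have h1 : f ∈ p.1 := hp.1 (Finset.mem_singleton_self f)
    refine (hF p f h1).trans_le ((min_le_right _ _).trans (le_trans ?_ hn.le))
    have : (n : ℝ) ≤ p.2 := by exact_mod_cast hp.2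
    gcongr
  obtain ⟨p, hp⟩ := (hlim.eventually hU).exists
  refine ⟨L p, hL p, B p, hp, (hB p).trans ?_⟩
  gcongr
  exact min_le_left _ _

theorem tendsto_dist_comp_of_isCompact {α β ι : Type*} [PseudoMetricSpace α]
    [PseudoMetricSpace β] {l : Filter ι} {V : Set α} (hV : IsCompact V) {f : α → β}
    (hf : Continuous f) {u v : ι → α} (hu : ∀ i, u i ∈ V)
    (huv : Tendsto (fun i => dist (u i) (v i)) l (𝓝 0)) :
    Tendsto (fun i => dist (f (u i)) (f (v i))) l (𝓝 0) := by
  have huv' := (tendsto_uniformity_iff_dist_tendsto_zero (f := fun i => (u i, v i))).2 huv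
  refine (tendsto_uniformity_iff_dist_tendsto_zero (f := fun i => (f (u i), f (v i)))).1 ?_
  intro r hr
  have h := huv' (hV.uniformContinuousAt_of_continuousAt f (fun _ _ => hf.continuousAt) hr)
  rw [mem_map] at h ⊢
  filter_upwards [h] with i hi using hi (hu i)

/-- If the empirical measures of a sequence asymptotically agree, on every observable, with
a sequence in a compact set clustering at every point of that set, their limit points form that
set. -/
theorem limitMeasures_eq_of_tendsto_sub {X : Type*} [MetricSpace X]
    [TopologicalSpace.SeparableSpace X] [MeasurableSpace X] [BorelSpace X]
    {V : Set (ProbabilityMeasure X)} (hV : IsCompact V) {x : ℕ → X}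
    {m : ℕ → ProbabilityMeasure X} (hm : ∀ n, m n ∈ V) (hclus : ∀ v ∈ V, MapClusterPt v atTop m)
    (hxm : ∀ f : BoundedContinuousFunction X ℝ,
      Tendsto (fun n => ∫ a, f a ∂(avgDirac x n).toMeasure - ∫ a, f a ∂(m n).toMeasure)
        atTop (𝓝 0)) :
    limitMeasures x = V := by
  have key : ∀ {φ : ℕ → ℕ} {v}, Tendsto φ atTop atTop → Tendsto (m ∘ φ) atTop (𝓝 v) →
      Tendsto (fun k => avgDirac x (φ k)) atTop (𝓝 v) := by
    intro φ v hφ hv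
    rw [ProbabilityMeasure.tendsto_iff_forall_integral_tendsto] at hv ⊢
    intro f
    simpa using ((hxm f).comp hφ).add (hv f)
  ext v
  constructor
  · rintro ⟨φ, hφ, hv⟩
    obtain ⟨w, hw, ψ, hψ, hlim⟩ := hV.tendsto_subseq fun k => hm (φ k)
    have h1 := key (hφ.tendsto_atTop.comp hψ.tendsto_atTop) hlim
    rwa [tendsto_nhds_unique (hv.comp hψ.tendsto_atTop) h1]
  · intro hv
    obtain ⟨φ, hφ, hlim⟩ := (hclus v hv).tendsto_subseq
    exact ⟨φ, hφ, key hφ.tendsto_atTop hlim⟩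

theorem stmt17 {X : Type*} [MetricSpace X] [TopologicalSpace.SeparableSpace X]
    [CompleteSpace X] [MeasurableSpace X] [BorelSpace X]
    (hd : ∃ C, ∀ a b : X, dist a b ≤ C)
    (T : X → X) (hT : Continuous T)
    (V : Set (ProbabilityMeasure X)) (hV1 : V.Nonempty) (hV2 : IsCompact V)
    (hV3 : IsPreconnected V)
    (hVinv : ∀ μ ∈ V, μ.toMeasure.map T = μ.toMeasure) :
    ∃ x : ℕ → X, IsAAPO T x ∧ limitMeasures x = V := by
  obtain ⟨C, hC⟩ := hd
  let _ : PseudoMetricSpace (ProbabilityMeasure X) :=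
    TopologicalSpace.pseudoMetrizableSpacePseudoMetric _
  have : CompactSpace V := isCompact_iff_compactSpace.1 hV2
  have : PreconnectedSpace V := Subtype.preconnectedSpace hV3
  have : Nonempty V := hV1.to_subtype
  obtain ⟨μ, hμstep, hμclus⟩ := exists_slow_seq_forall_mapClusterPt (Y := V)
  choose L hL B hBμ hBjump using fun k : ℕ => exists_block hC hT (μ k) (hVinv _ (μ k).2)
    (Metric.ball_mem_nhds _ (Nat.one_div_pos_of_nat (α := ℝ) (n := k)))
    (Nat.one_div_pos_of_nat (α := ℝ) (n := k))
  obtain ⟨r, hr, hS⟩ := exists_fast_repetitions hL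
  set ℓ : ℕ → ℕ := fun k => r k * L k with hℓdef
  have hℓ : ∀ k, 0 < ℓ k := fun k => Nat.mul_pos (hr k) (hL k)
  have hone := tendsto_one_div_add_atTop_nhds_zero_nat (𝕜 := ℝ)
  have hC0 : 0 ≤ C := dist_nonneg.trans (hC (B 0 0) (B 0 0))
  let x : ℕ → X := fun i => B (segPos ℓ i).1 ((segPos ℓ i).2 % L (segPos ℓ i).1)
  have hjump : ∀ i, dist (T (x i)) (x (i + 1)) ≤ blockJump T C (L (segPos ℓ i).1)
      (B (segPos ℓ i).1) ((segPos ℓ i).2 % L (segPos ℓ i).1) := by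
    intro i
    rw [blockJump]
    split_ifs with h
    · obtain ⟨h1, -⟩ := segPos_spec hℓ i
      have hmod : ((segPos ℓ i).2 + 1) % L (segPos ℓ i).1 =
          (segPos ℓ i).2 % L (segPos ℓ i).1 + 1 := by
        rw [← Nat.mod_add_mod, Nat.mod_eq_of_lt h]
      have h2 : (segPos ℓ i).2 + 1 < ℓ (segPos ℓ i).1 := by
        refine lt_of_le_of_ne h1 fun h3 => ?_
        rw [h3, hℓdef] at hmod
        simp at hmod
      have h3 : x (i + 1) = B (segPos ℓ i).1 ((segPos ℓ i).2 % L (segPos ℓ i).1 + 1) := by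
        simp only [x]
        rw [segPos, if_pos h2, ← hmod]
      rw [h3]
    · exact hC _ _
  have hjump0 : ∀ k s, 0 ≤ blockJump T C (L k) (B k) s := fun k s => by
    rw [blockJump]
    split_ifs
    exacts [dist_nonneg, hC0]
  have hjumpC : ∀ k s, blockJump T C (L k) (B k) s ≤ C := fun k s => by
    rw [blockJump]
    split_ifs
    exacts [hC _ _, le_rfl]
  refine ⟨x, ?_, limitMeasures_eq_of_tendsto_sub hV2 (m := fun n => μ (segPos ℓ n).1)
    (fun n => (μ _).2) (fun v hv => ?_) fun f => ?_⟩
  · have h := tendsto_average_sub_of_blocks hL hr hS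
      (g := fun k s => blockJump T C (L k) (B k) s) (c := fun _ => 0)
      (e := fun k => 1 / ((k : ℝ) + 1)) (M := C)
      (fun k s => by rw [abs_of_nonneg (hjump0 k s)]; exact hjumpC k s)
      (fun _ => by simpa) (fun k => by
        simp only [sub_zero]
        rw [abs_of_nonneg (Finset.sum_nonneg fun s _ => hjump0 k s)]
        exact hBjump k) hone (by simp)
    simp only [sub_zero] at h
    refine squeeze_zero (fun n => div_nonneg (Finset.sum_nonneg fun _ _ => dist_nonneg)
      n.cast_nonneg) (fun n => ?_) h
    gcongr with i
    exact hjump i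
  · have h1 : MapClusterPt v atTop fun k => (μ k : ProbabilityMeasure X) :=
      (hμclus ⟨v, hv⟩).continuousAt_comp continuous_subtype_val.continuousAt
    have h2 : (fun n => (μ (segPos ℓ n).1 : ProbabilityMeasure X)) ∘ segStart ℓ =
        fun k => (μ k : ProbabilityMeasure X) := by
      ext1 k
      simp [segPos_segStart hℓ]
    exact (h2 ▸ h1).of_comp (tendsto_segStart hℓ)
  · let I : ProbabilityMeasure X → ℝ := fun ν => ∫ a, f a ∂ν.toMeasure
    have hI : Continuous I := continuous_iff_continuousAt.2 fun ν =>
      ProbabilityMeasure.tendsto_iff_forall_integral_tendsto.1 tendsto_id f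
    have hfM : ∀ a, |f a| ≤ ‖f‖ := f.norm_coe_le_norm
    have hIM : ∀ ν, |I ν| ≤ ‖f‖ := fun ν => f.norm_integral_le_norm ν.toMeasure
    have hBI : Tendsto (fun k => dist (I (μ k)) (I (avgDirac (B k) (L k)))) atTop (𝓝 0) :=
      tendsto_dist_comp_of_isCompact hV2 hI (fun k => (μ k).2)
        (squeeze_zero (fun _ => dist_nonneg)
          (fun k => (dist_comm _ _).trans_le (Metric.mem_ball.1 (hBμ k)).le) hone)
    have hstep : Tendsto (fun k => dist (I (μ k)) (I (μ (k + 1)))) atTop (𝓝 0) :=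
      tendsto_dist_comp_of_isCompact hV2 hI (fun k => (μ k).2) hμstep
    have h := tendsto_average_sub_of_blocks hL hr hS
      (g := fun k s => f (B k s)) (c := fun k => I (μ k)) (M := ‖f‖)
      (fun k s => hfM _) (fun _ => hIM _) (fun k => by
        have hLk : (0 : ℝ) < L k := by exact_mod_cast hL k
        rw [dist_comm, Real.dist_eq]
        simp only [I]
        rw [integral_avgDirac f _ (hL k)]
        rw [← abs_of_pos hLk, ← abs_mul, abs_of_pos hLk, sub_mul, div_mul_cancel₀ _ hLk.ne']
        simp [Finset.sum_sub_distrib, mul_comm]) hBI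
      (squeeze_zero_norm (fun k => by
        rw [dist_comm, Real.dist_eq, Real.norm_eq_abs]) hstep)
    refine h.congr' ?_
    filter_upwards [eventually_gt_atTop 0] with n hn
    rw [integral_avgDirac f x hn]
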